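/- Let A ∈ ℂ^{n×n} be Hermitian PSD and let rel(A) = inf{ Π_i D_{ii} : D diagonal, D ⪰ A }. Then rel(A) ≥ per(A) ≥ e^{−n(γ+1)} · rel(A), where γ is Euler's constant. -/

import Mathlib

open scoped Matrix ComplexOrder

noncomputable def perm {n : ℕ} (M : Matrix (Fin n) (Fin n) ℂ) : ℂ :=
  ∑ σ : Equiv.Perm (Fin n), ∏ i, M i (σ i)

def relSet {n : ℕ} (A : Matrix (Fin n) (Fin n) ℂ) : Set ℝ :=
  {t | ∃ d : Fin n → ℝ,
    (Matrix.diagonal (fun i => (d i : ℂ)) - A).PosSemidef ∧ ∏ i, d i = t}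

lemma perm_sym {n : ℕ} (A : Matrix (Fin n) (Fin n) ℂ) :
    ∑ σ : Equiv.Perm (Fin n), ∑ τ : Equiv.Perm (Fin n), ∏ k, A (σ k) (τ k)
      = (n.factorial : ℂ) * perm A := by
  have h : ∀ σ : Equiv.Perm (Fin n), ∑ τ : Equiv.Perm (Fin n), ∏ k, A (σ k) (τ k) = perm A := by
    intro σ
    unfold perm
    refine Fintype.sum_equiv (Equiv.mulRight σ⁻¹) _ _ fun τ => ?_
    refine Fintype.prod_equiv σ _ _ fun k => ?_
    simp
  simp [h, Fintype.card_perm]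

lemma prod_psd {ι κ : Type*} [Fintype κ] [DecidableEq κ] [DecidableEq ι] (s : Finset ι)
    (X Y : ι → Matrix κ κ ℂ)
    (hX : ∀ i, (X i).PosSemidef) (hXY : ∀ i, (Y i - X i).PosSemidef) :
    (Matrix.of fun a b => ∏ i ∈ s, X i a b).PosSemidef ∧
    ((Matrix.of fun a b => ∏ i ∈ s, Y i a b) - (Matrix.of fun a b => ∏ i ∈ s, X i a b)).PosSemidef := by
  induction s using Finset.induction_on with
  | empty =>
    constructor
    · have h := Matrix.posSemidef_vecMulVec_self_star (R := ℂ) (fun _ : κ => (1:ℂ))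
      convert h using 1
      ext a b
      simp [Matrix.vecMulVec_apply]
    · simp [Matrix.PosSemidef.zero]
  | insert i s hi ih =>
    obtain ⟨h1, h2⟩ := ih
    constructor
    · have e : (Matrix.of fun a b => ∏ j ∈ insert i s, X j a b)
          = (X i) ⊙ (Matrix.of fun a b => ∏ j ∈ s, X j a b) := by
        ext a b
        simp [Finset.prod_insert hi]
      rw [e]
      exact (hX i).hadamard h1
    · have hY : (Y i).PosSemidef := by simpa using (hXY i).add (hX i)
      have e : (Matrix.of fun a b => ∏ j ∈ insert i s, Y j a b)
          - (Matrix.of fun a b => ∏ j ∈ insert i s, X j a b)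
          = (Y i) ⊙ ((Matrix.of fun a b => ∏ j ∈ s, Y j a b) - (Matrix.of fun a b => ∏ j ∈ s, X j a b))
            + (Y i - X i) ⊙ (Matrix.of fun a b => ∏ j ∈ s, X j a b) := by
        ext a b
        simp [Finset.prod_insert hi]
        ring
      rw [e]
      exact (hY.hadamard h2).add ((hXY i).hadamard h1)

lemma perm_mono {n : ℕ} (A D : Matrix (Fin n) (Fin n) ℂ) (hA : A.PosSemidef)
    (hD : (D - A).PosSemidef) : (perm A).re ≤ (perm D).re := by
  have h := (prod_psd (κ := Equiv.Perm (Fin n)) Finset.univ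
    (fun k : Fin n => A.submatrix (fun σ => σ k) (fun σ => σ k))
    (fun k : Fin n => D.submatrix (fun σ => σ k) (fun σ => σ k))
    (fun k => hA.submatrix _) (fun k => hD.submatrix _)).2
  have h2 := h.dotProduct_mulVec_nonneg (fun _ => 1)
  have h3 : (star (fun _ : Equiv.Perm (Fin n) => (1:ℂ))) ⬝ᵥ (((Matrix.of fun a b : Equiv.Perm (Fin n) => ∏ i, (D.submatrix (fun σ : Equiv.Perm (Fin n) => σ i) (fun σ : Equiv.Perm (Fin n) => σ i)) a b) - (Matrix.of fun a b => ∏ i, (A.submatrix (fun σ : Equiv.Perm (Fin n) => σ i) (fun σ : Equiv.Perm (Fin n) => σ i)) a b)) *ᵥ (fun _ => 1)) = (n.factorial : ℂ) * (perm D - perm A) := by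
    rw [mul_sub, ← perm_sym, ← perm_sym]
    simp [dotProduct, Matrix.mulVec, Finset.sum_sub_distrib]
  rw [h3] at h2
  have h4 := (Complex.le_def.1 h2).1
  have h5 : (0:ℝ) < n.factorial := by exact_mod_cast n.factorial_pos
  have h6 : ((n.factorial : ℂ) * (perm D - perm A)).re = n.factorial * ((perm D).re - (perm A).re) := by
    simp
  rw [h6] at h4
  rw [Complex.zero_re] at h4
  have := nonneg_of_mul_nonneg_right h4 h5
  linarith

lemma perm_diag {n : ℕ} (d : Fin n → ℂ) : perm (Matrix.diagonal d) = ∏ i, d i := by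
  unfold perm
  rw [Finset.sum_eq_single 1]
  · simp
  · intro σ _ hσ
    obtain ⟨i, hi⟩ : ∃ i, σ i ≠ i := by
      by_contra! h
      exact hσ (Equiv.ext h)
    exact Finset.prod_eq_zero (Finset.mem_univ i) (Matrix.diagonal_apply_ne _ (Ne.symm hi))
  · simp

lemma upper {n : ℕ} (A : Matrix (Fin n) (Fin n) ℂ) (hA : A.PosSemidef) :
    ∀ t ∈ relSet A, (perm A).re ≤ t := by
  rintro t ⟨d, hd, rfl⟩
  refine (perm_mono A _ hA hd).trans_eq ?_
  rw [perm_diag, ← Complex.ofReal_prod, Complex.ofReal_re]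

lemma perm_rank_one {n : ℕ} (w : Fin n → ℂ) :
    (perm (Matrix.vecMulVec w (star w))).re = n.factorial * ∏ i, ‖w i‖ ^ 2 := by
  have : perm (Matrix.vecMulVec w (star w)) = ((n.factorial * ∏ i, ‖w i‖ ^ 2 : ℝ) : ℂ) := by
    unfold perm
    have h : ∀ σ : Equiv.Perm (Fin n), ∏ i, Matrix.vecMulVec w (star w) i (σ i) = ∏ i, ((‖w i‖:ℂ) ^ 2) := by
      intro σ
      simp only [Matrix.vecMulVec_apply, Pi.star_apply, Finset.prod_mul_distrib]
      rw [Equiv.prod_comp σ (fun i => star (w i)), ← Finset.prod_mul_distrib]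
      refine Finset.prod_congr rfl fun i _ => ?_
      exact Complex.mul_conj' (w i)
    simp [h, Fintype.card_perm]
  rw [this, Complex.ofReal_re]

lemma rank_one_bound {n m : ℕ} (B : Matrix (Fin m) (Fin n) ℂ) (x : Fin m → ℂ) :
    n.factorial * ∏ i, ‖(Bᴴ *ᵥ x) i‖ ^ 2 ≤ (∑ j, ‖x j‖ ^ 2) ^ n * (perm (Bᴴ * B)).re := by
  set c : ℝ := ∑ j, ‖x j‖ ^ 2 with hc
  have hpsd : (((c:ℂ) • (Bᴴ * B)) - Matrix.vecMulVec (Bᴴ *ᵥ x) (star (Bᴴ *ᵥ x))).PosSemidef := by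
    have h1 : (((c:ℂ) • (1 : Matrix (Fin m) (Fin m) ℂ)) - Matrix.vecMulVec x (star x)).PosSemidef := by
      refine Matrix.PosSemidef.of_dotProduct_mulVec_nonneg ?_ ?_
      · refine Matrix.IsHermitian.sub ?_ (Matrix.posSemidef_vecMulVec_self_star x).1
        rw [Matrix.IsHermitian, Matrix.conjTranspose_smul]
        simp
      · intro z
        have e : star z ⬝ᵥ (((c:ℂ) • (1 : Matrix (Fin m) (Fin m) ℂ)) - Matrix.vecMulVec x (star x)) *ᵥ z
          = ((c * ∑ j, ‖z j‖ ^ 2 - ‖star x ⬝ᵥ z‖ ^ 2 : ℝ) : ℂ) := by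
          rw [Matrix.sub_mulVec, dotProduct_sub, Matrix.smul_mulVec, Matrix.one_mulVec, dotProduct_smul, Matrix.vecMulVec_mulVec]
          have e1 : star z ⬝ᵥ z = ((∑ j, ‖z j‖ ^ 2 : ℝ) : ℂ) := by
            simp [dotProduct, Complex.conj_mul']
          have e2 : star z ⬝ᵥ x = star (star x ⬝ᵥ z) := by
            rw [Matrix.star_dotProduct]
          rw [e1]
          push_cast
          congr 1
          rw [← Complex.conj_mul']
          simp [e2]
          ring
        rw [e]
        have cs : ‖star x ⬝ᵥ z‖ ^ 2 ≤ c * ∑ j, ‖z j‖ ^ 2 := by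
          have := norm_inner_le_norm (𝕜 := ℂ) (WithLp.toLp 2 x : EuclideanSpace ℂ (Fin m)) (WithLp.toLp 2 z)
          have := pow_le_pow_left₀ (norm_nonneg _) this 2
          rw [mul_pow, EuclideanSpace.norm_sq_eq, EuclideanSpace.norm_sq_eq, EuclideanSpace.inner_toLp_toLp, dotProduct_comm] at this
          simpa [hc] using this
        exact_mod_cast sub_nonneg.2 cs
    convert h1.conjTranspose_mul_mul_same B using 1
    rw [Matrix.mul_sub, Matrix.sub_mul]
    congr 1
    · simp
    · rw [Matrix.mul_vecMulVec, Matrix.vecMulVec_mul, Matrix.star_mulVec]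
      simp
  have h := perm_mono _ _ (Matrix.posSemidef_vecMulVec_self_star _) hpsd
  rw [perm_rank_one] at h
  refine h.trans_eq ?_
  have : perm ((c:ℂ) • (Bᴴ * B)) = ((c ^ n : ℝ) : ℂ) * perm (Bᴴ * B) := by
    unfold perm
    simp [Finset.prod_mul_distrib, Finset.mul_sum]
  rw [this, Complex.re_ofReal_mul]

open MeasureTheory ProbabilityTheory in
lemma log_int : IntegrableOn (fun t : ℝ => Real.log t * Real.exp (-t)) (Set.Ioi 0) ∧
    ∫ t in Set.Ioi (0:ℝ), Real.log t * Real.exp (-t) = -Real.eulerMascheroniConstant := by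
  constructor
  · have h := (mellin_hasDerivAt_of_isBigO_rpow (E := ℂ) (a := 2) (b := 0) (s := 1)
      (f := fun x => ((Real.exp (-x) : ℝ) : ℂ)) ?_ ?_ (by simp) ?_ (by simp)).1
    · unfold MellinConvergent at h
      have h' : IntegrableOn _ (Set.Ioi (0:ℝ)) := h.re
      refine h'.congr_fun (fun t _ => ?_) measurableSet_Ioi
      simp [-Complex.ofReal_exp]
    · refine (Continuous.continuousOn ?_).locallyIntegrableOn measurableSet_Ioi
      exact Complex.continuous_ofReal.comp (Real.continuous_exp.comp continuous_neg)
    · rw [← Asymptotics.isBigO_norm_left]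
      simp_rw [Complex.norm_real, Asymptotics.isBigO_norm_left]
      simpa only [neg_one_mul] using (isLittleO_exp_neg_mul_rpow_atTop zero_lt_one _).isBigO
    · simp_rw [neg_zero, Real.rpow_zero]
      refine Asymptotics.isBigO_const_of_tendsto (?_ : Filter.Tendsto _ _ (nhds (1 : ℂ))) one_ne_zero
      rw [(by simp : (1 : ℂ) = Real.exp (-0))]
      exact (Complex.continuous_ofReal.comp (Real.continuous_exp.comp continuous_neg)).continuousWithinAt
  · have h1 := Complex.hasDerivAt_GammaIntegral (s := 1) (by simp)
    have h2 : HasDerivAt Complex.Gamma (-Real.eulerMascheroniConstant) 1 := Complex.hasDerivAt_Gamma_one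
    have h3 : HasDerivAt Complex.GammaIntegral (-Real.eulerMascheroniConstant) 1 := by
      refine h2.congr_of_eventuallyEq ?_
      have : {z : ℂ | 0 < z.re} ∈ nhds (1:ℂ) :=
        (isOpen_lt continuous_const Complex.continuous_re).mem_nhds (by simp)
      filter_upwards [this] with z hz
      exact (Complex.Gamma_eq_integral hz).symm
    have h4 := h1.unique h3
    simp only [sub_self, Complex.cpow_zero, one_mul] at h4
    rw [← Complex.ofReal_inj, ← integral_complex_ofReal]
    simpa using h4

open MeasureTheory ProbabilityTheory in
lemma stdGaussian_C : stdGaussian ℂ = (volume : Measure ℂ).withDensity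
    (fun z => ENNReal.ofReal ((2 * Real.pi)⁻¹ * Real.exp (-(‖z‖ ^ 2 / 2)))) := by
  have hint : Integrable (fun z : ℂ => (2 * Real.pi)⁻¹ * Real.exp (-(‖z‖ ^ 2 / 2))) := by
    have := (integrable_fun_norm_addHaar (volume : Measure ℂ) (f := fun y => Real.exp (-(1/2) * y ^ 2))).2 (by
      simpa using (integrable_mul_exp_neg_mul_sq (b := 1/2) (by norm_num)).integrableOn)
    refine (this.const_mul (2 * Real.pi)⁻¹).congr (Filter.Eventually.of_forall fun z => ?_)
    simp only
    congr 2
    ring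
  have : IsFiniteMeasure ((volume : Measure ℂ).withDensity
    (fun z => ENNReal.ofReal ((2 * Real.pi)⁻¹ * Real.exp (-(‖z‖ ^ 2 / 2))))) :=
    isFiniteMeasure_withDensity_ofReal hint.2
  apply Measure.ext_of_charFun
  ext t
  rw [charFun_stdGaussian, charFun_apply, integral_withDensity_eq_integral_toReal_smul (by fun_prop) (by simp)]
  have h := GaussianFourier.integral_cexp_neg_mul_sq_norm_add (V := ℂ) (b := 1/2) (by norm_num) Complex.I t
  have e : ∀ z : ℂ, (ENNReal.ofReal ((2 * Real.pi)⁻¹ * Real.exp (-(‖z‖ ^ 2 / 2)))).toReal • Complex.exp ((inner ℝ z t : ℝ) * Complex.I) = ((2 * Real.pi)⁻¹ : ℂ) * Complex.exp (-(1/2) * ‖z‖ ^ 2 + Complex.I * (inner ℝ t z : ℝ)) := by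
    intro z
    rw [ENNReal.toReal_ofReal (by positivity), Complex.exp_add, real_inner_comm]
    simp only [Complex.real_smul]
    push_cast
    rw [mul_assoc]
    congr 3
    · ring
    · ring
  simp_rw [e]
  rw [integral_const_mul, h]
  simp only [Complex.finrank_real_complex, Complex.I_sq]
  have hpi : (Real.pi : ℂ) ≠ 0 := by exact_mod_cast Real.pi_ne_zero
  norm_num
  field_simp

open MeasureTheory ProbabilityTheory in
lemma gauss_C (G : ℝ → ℝ) : (IntegrableOn (fun s => Real.exp (-s) * G (2 * s)) (Set.Ioi 0) →
      Integrable (fun z : ℂ => G (‖z‖ ^ 2)) (stdGaussian ℂ)) ∧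
    ∫ z, G (‖z‖ ^ 2) ∂(stdGaussian ℂ) = ∫ s in Set.Ioi (0:ℝ), Real.exp (-s) * G (2 * s) := by
  have key : ∀ y : ℝ, y ^ (Module.finrank ℝ ℂ - 1) • (((2 * Real.pi)⁻¹ * Real.exp (-(y ^ 2 / 2))) • G (y ^ 2))
    = (2 * Real.pi)⁻¹ * ((2 * y ^ ((2:ℝ) - 1)) • ((fun t => (1/2) * (Real.exp (-(t / 2)) * G t)) (y ^ (2:ℝ)))) := by
    intro y
    norm_num
    ring
  have key2 : ∀ y : ℝ, y ^ (Module.finrank ℝ ℂ - 1) • (((2 * Real.pi)⁻¹ * Real.exp (-(y ^ 2 / 2))) • G (y ^ 2))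
    = (2 * Real.pi)⁻¹ * ((|2| * y ^ ((2:ℝ) - 1)) • ((fun t => (1/2) * (Real.exp (-(t / 2)) * G t)) (y ^ (2:ℝ)))) := by
    intro y
    norm_num
    ring
  have nn : ∀ z : ℂ, (ENNReal.ofReal ((2 * Real.pi)⁻¹ * Real.exp (-(‖z‖ ^ 2 / 2)))).toReal
      = (2 * Real.pi)⁻¹ * Real.exp (-(‖z‖ ^ 2 / 2)) :=
    fun z => ENNReal.toReal_ofReal (by positivity)
  have scale : ∀ s : ℝ, Real.exp (-s) * G (2 * s) = (fun t => Real.exp (-(t / 2)) * G t) (2 * s) := by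
    intro s
    simp
  constructor
  · intro hi
    rw [stdGaussian_C, integrable_withDensity_iff_integrable_smul' (by fun_prop) (by simp)]
    simp_rw [nn]
    rw [integrable_fun_norm_addHaar (volume : Measure ℂ) (f := fun y => ((2 * Real.pi)⁻¹ * Real.exp (-(y ^ 2 / 2))) • G (y ^ 2))]
    simp_rw [key2]
    refine Integrable.const_mul ?_ _
    refine (integrableOn_Ioi_comp_rpow_iff (fun t => (1/2) * (Real.exp (-(t / 2)) * G t)) two_ne_zero).2 ?_
    refine Integrable.const_mul ?_ _
    simp_rw [scale] at hi
    have := (integrableOn_Ioi_comp_mul_left_iff (fun t => Real.exp (-(t / 2)) * G t) 0 two_pos).1 hi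
    simpa [IntegrableOn] using this
  · rw [stdGaussian_C, integral_withDensity_eq_integral_toReal_smul (by fun_prop) (by simp)]
    simp_rw [nn]
    rw [integral_fun_norm_addHaar (volume : Measure ℂ) (f := fun y => ((2 * Real.pi)⁻¹ * Real.exp (-(y ^ 2 / 2))) • G (y ^ 2))]
    simp_rw [key, scale]
    rw [integral_const_mul, integral_comp_rpow_Ioi_of_pos (g := fun t => (1/2) * (Real.exp (-(t / 2)) * G t)) two_pos,
      integral_comp_mul_left_Ioi (fun t => Real.exp (-(t / 2)) * G t) 0 two_pos, integral_const_mul]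
    have hv : (volume : Measure ℂ).real (Metric.ball 0 1) = Real.pi := by
      simp [Measure.real, Complex.volume_ball]
    rw [hv]
    have hpi := Real.pi_ne_zero
    simp
    field_simp

open MeasureTheory ProbabilityTheory in
lemma gauss_log : Integrable (fun z : ℂ => Real.log (‖z‖ ^ 2)) (stdGaussian ℂ) ∧
    ∫ z, Real.log (‖z‖ ^ 2) ∂(stdGaussian ℂ) = Real.log 2 - Real.eulerMascheroniConstant := by
  obtain ⟨h1, h2⟩ := gauss_C Real.log
  obtain ⟨h3, h4⟩ := log_int
  have e : Set.EqOn (fun s : ℝ => Real.log 2 * Real.exp (-s) + Real.log s * Real.exp (-s)) (fun s => Real.exp (-s) * Real.log (2 * s)) (Set.Ioi 0) := by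
    intro s hs
    have : s ≠ 0 := ne_of_gt hs
    simp only
    rw [Real.log_mul two_ne_zero this]
    ring
  have hi : IntegrableOn (fun s : ℝ => Real.log 2 * Real.exp (-s)) (Set.Ioi 0) :=
    (integrableOn_exp_neg_Ioi 0).const_mul _
  refine ⟨h1 ((hi.add h3).congr_fun e measurableSet_Ioi), ?_⟩
  rw [h2, ← setIntegral_congr_fun measurableSet_Ioi e, integral_add hi h3, h4, integral_const_mul, integral_exp_neg_Ioi_zero]
  ring

open MeasureTheory ProbabilityTheory in
lemma gauss_sq : Integrable (fun z : ℂ => ‖z‖ ^ 2) (stdGaussian ℂ) ∧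
    ∫ z, ‖z‖ ^ 2 ∂(stdGaussian ℂ) = 2 := by
  obtain ⟨h1, h2⟩ := gauss_C id
  have hi : IntegrableOn (fun s : ℝ => Real.exp (-s) * s ^ ((2:ℝ) - 1)) (Set.Ioi 0) :=
    Real.GammaIntegral_convergent two_pos
  have hg := Real.Gamma_eq_integral (s := 2) two_pos
  rw [Real.Gamma_two] at hg
  have e : (fun s : ℝ => 2 * (Real.exp (-s) * s ^ ((2:ℝ) - 1))) = (fun s => Real.exp (-s) * id (2 * s)) := by
    ext s
    norm_num
    ring
  refine ⟨h1 ?_, ?_⟩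
  · rw [← e]
    exact hi.const_mul 2
  · simp only [id] at h2 e
    rw [h2, ← e, integral_const_mul, ← hg]
    norm_num

open MeasureTheory ProbabilityTheory in
lemma gauss_law {m : ℕ} (a : Fin m → ℂ) :
    (stdGaussian (EuclideanSpace ℂ (Fin m))).map (fun g => ∑ j, a j * g j)
      = (stdGaussian ℂ).map (fun z => ((Real.sqrt (∑ j, ‖a j‖ ^ 2) : ℝ) : ℂ) * z) := by
  have m1 : Measurable (fun g : EuclideanSpace ℂ (Fin m) => ∑ j, a j * g j) := by fun_prop
  have m2 : Measurable (fun z : ℂ => ((Real.sqrt (∑ j, ‖a j‖ ^ 2) : ℝ) : ℂ) * z) := by fun_prop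
  have := Measure.isProbabilityMeasure_map (μ := stdGaussian (EuclideanSpace ℂ (Fin m))) m1.aemeasurable
  have := Measure.isProbabilityMeasure_map (μ := stdGaussian ℂ) m2.aemeasurable
  apply Measure.ext_of_charFun
  ext t
  rw [charFun_apply, charFun_apply, integral_map m1.aemeasurable (by fun_prop), integral_map m2.aemeasurable (by fun_prop)]
  let v : EuclideanSpace ℂ (Fin m) := WithLp.toLp 2 (fun j => star (a j) * t)
  have e1 : ∀ g : EuclideanSpace ℂ (Fin m), (inner ℝ (∑ j, a j * g j) t : ℝ) = inner ℝ g v := by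
    intro g
    rw [PiLp.inner_apply]
    simp only [Complex.inner, v]
    rw [map_sum, Finset.mul_sum, Complex.re_sum]
    refine Finset.sum_congr rfl fun j _ => ?_
    rw [map_mul]
    congr 1
    simp only [RCLike.star_def]
    ring
  have e2 : ∀ z : ℂ, (inner ℝ (((Real.sqrt (∑ j, ‖a j‖ ^ 2) : ℝ) : ℂ) * z) t : ℝ) = inner ℝ z ((Real.sqrt (∑ j, ‖a j‖ ^ 2) : ℝ) • t) := by
    intro z
    rw [Complex.inner, Complex.inner]
    simp
    ring
  simp_rw [e1, e2]
  rw [← charFun_apply, ← charFun_apply, charFun_stdGaussian, charFun_stdGaussian]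
  congr 3
  norm_cast
  rw [EuclideanSpace.norm_sq_eq, norm_smul, mul_pow, Real.norm_eq_abs, sq_abs, Real.sq_sqrt (by positivity)]
  simp [v, mul_pow, Finset.sum_mul]

open MeasureTheory ProbabilityTheory in
lemma gauss_lin {m : ℕ} (a : Fin m → ℂ) :
    (Integrable (fun g : EuclideanSpace ℂ (Fin m) => ‖∑ j, a j * g j‖ ^ 2) (stdGaussian _) ∧
    ∫ g, ‖∑ j, a j * g j‖ ^ 2 ∂(stdGaussian (EuclideanSpace ℂ (Fin m))) = 2 * ∑ j, ‖a j‖ ^ 2) ∧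
    (0 < ∑ j, ‖a j‖ ^ 2 → 
      (∀ᵐ g ∂(stdGaussian (EuclideanSpace ℂ (Fin m))), ∑ j, a j * g j ≠ 0) ∧
      Integrable (fun g : EuclideanSpace ℂ (Fin m) => Real.log (‖∑ j, a j * g j‖ ^ 2)) (stdGaussian _) ∧
      ∫ g, Real.log (‖∑ j, a j * g j‖ ^ 2) ∂(stdGaussian (EuclideanSpace ℂ (Fin m)))
        = Real.log (∑ j, ‖a j‖ ^ 2) + Real.log 2 - Real.eulerMascheroniConstant) := by
  have law := gauss_law a
  set q := ∑ j, ‖a j‖ ^ 2 with hq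
  have hq0 : 0 ≤ q := by positivity
  have m1 : Measurable (fun g : EuclideanSpace ℂ (Fin m) => ∑ j, a j * g j) := by fun_prop
  have m2 : Measurable (fun z : ℂ => ((Real.sqrt q : ℝ) : ℂ) * z) := by fun_prop
  have hn : ∀ z : ℂ, ‖((Real.sqrt q : ℝ) : ℂ) * z‖ ^ 2 = q * ‖z‖ ^ 2 := by
    intro z
    rw [norm_mul, mul_pow, Complex.norm_real, Real.norm_eq_abs, sq_abs, Real.sq_sqrt hq0]
  have tr1 : ∀ F : ℂ → ℝ, Measurable F → Integrable (fun z => F (((Real.sqrt q : ℝ) : ℂ) * z)) (stdGaussian ℂ) →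
      Integrable (fun g : EuclideanSpace ℂ (Fin m) => F (∑ j, a j * g j)) (stdGaussian _) := by
    intro F hF h
    have := (integrable_map_measure (g := F) hF.aestronglyMeasurable m2.aemeasurable).2 h
    rw [← law] at this
    exact (integrable_map_measure hF.aestronglyMeasurable m1.aemeasurable).1 this
  have tr2 : ∀ F : ℂ → ℝ, Measurable F → ∫ g, F (∑ j, a j * g j) ∂(stdGaussian (EuclideanSpace ℂ (Fin m))) =
      ∫ z, F (((Real.sqrt q : ℝ) : ℂ) * z) ∂(stdGaussian ℂ) := by
    intro F hF
    rw [← integral_map (f := F) m1.aemeasurable hF.aestronglyMeasurable, law, integral_map m2.aemeasurable hF.aestronglyMeasurable]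
  have hF1 : Measurable (fun z : ℂ => ‖z‖ ^ 2) := by fun_prop
  have hF2 : Measurable (fun z : ℂ => Real.log (‖z‖ ^ 2)) := by fun_prop
  refine ⟨⟨tr1 _ hF1 ?_, ?_⟩, fun hpos => ?_⟩
  · simp_rw [hn]
    exact gauss_sq.1.const_mul _
  · rw [tr2 _ hF1]
    simp_rw [hn]
    rw [integral_const_mul, gauss_sq.2]
    ring
  have hae : ∀ᵐ z ∂(stdGaussian ℂ), z ≠ 0 := by
    rw [stdGaussian_C]
    refine (withDensity_absolutelyContinuous _ _).ae_le ?_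
    exact Measure.ae_ne _ _
  have hl : (fun z : ℂ => Real.log (‖((Real.sqrt q : ℝ) : ℂ) * z‖ ^ 2)) =ᵐ[stdGaussian ℂ] (fun z => Real.log q + Real.log (‖z‖ ^ 2)) := by
    filter_upwards [hae] with z hz
    rw [hn, Real.log_mul hpos.ne' (by positivity)]
  refine ⟨?_, tr1 _ hF2 ?_, ?_⟩
  · have : ∀ᵐ w ∂((stdGaussian ℂ).map (fun z => ((Real.sqrt q : ℝ) : ℂ) * z)), w ≠ 0 := by
      refine (ae_map_iff m2.aemeasurable (measurableSet_singleton 0).compl).2 ?_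
      filter_upwards [hae] with z hz
      simp [hz, Real.sqrt_eq_zero', hpos]
    rw [← law] at this
    exact ae_of_ae_map m1.aemeasurable this
  · exact ((integrable_const _).add gauss_log.1).congr hl.symm
  · rw [tr2 _ hF2, integral_congr_ae hl, integral_add (integrable_const _) gauss_log.1, gauss_log.2]
    simp
    ring

open scoped MatrixOrder Matrix.Norms.L2Operator in
lemma psd_factor {n : ℕ} (A : Matrix (Fin n) (Fin n) ℂ) (hA : A.PosSemidef) :
    ∃ B : Matrix (Fin n) (Fin n) ℂ, A = Bᴴ * B :=
  CStarAlgebra.nonneg_iff_eq_star_mul_self.mp hA.nonneg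

open MeasureTheory ProbabilityTheory in
lemma lower_core {n m k : ℕ} (hn : 0 < n) (B : Matrix (Fin m) (Fin n) ℂ) (U : Matrix (Fin m) (Fin k) ℂ)
    (hU : ∑ i, ∑ j, ‖U i j‖ ^ 2 = 1) (hq : ∀ i, 0 < ∑ j, ‖(Bᴴ * U) i j‖ ^ 2) :
    n.factorial * Real.exp (-(n * Real.eulerMascheroniConstant)) * ∏ i, ∑ j, ‖(Bᴴ * U) i j‖ ^ 2
      ≤ (perm (Bᴴ * B)).re := by
  set P := (perm (Bᴴ * B)).re with hP
  let μ := stdGaussian (EuclideanSpace ℂ (Fin k))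
  have hw : ∀ (g : EuclideanSpace ℂ (Fin k)) i,
      (Bᴴ *ᵥ (fun l => ∑ j, U l j * g j)) i = ∑ j, (Bᴴ * U) i j * g j := by
    intro g i
    have : (fun l => ∑ j, U l j * g j) = U *ᵥ (g : Fin k → ℂ) := rfl
    rw [this, Matrix.mulVec_mulVec]
    rfl
  have hb : ∀ g : EuclideanSpace ℂ (Fin k), n.factorial * ∏ i, ‖∑ j, (Bᴴ * U) i j * g j‖ ^ 2
      ≤ (∑ l, ‖∑ j, U l j * g j‖ ^ 2) ^ n * P := by
    intro g
    have := rank_one_bound B (fun l => ∑ j, U l j * g j)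
    simp_rw [hw] at this
    exact this
  have hae : ∀ᵐ g ∂μ, ∀ i, ∑ j, (Bᴴ * U) i j * g j ≠ 0 :=
    ae_all_iff.2 fun i => ((gauss_lin (fun j => (Bᴴ * U) i j)).2 (hq i)).1
  have hfac : (0:ℝ) < n.factorial := by exact_mod_cast n.factorial_pos
  have hpos : ∀ g : EuclideanSpace ℂ (Fin k), (∀ i, ∑ j, (Bᴴ * U) i j * g j ≠ 0) →
      0 < n.factorial * ∏ i, ‖∑ j, (Bᴴ * U) i j * g j‖ ^ 2 := by
    intro g hg
    refine mul_pos hfac (Finset.prod_pos fun i _ => ?_)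
    have := norm_pos_iff.2 (hg i)
    positivity
  have hx0 : ∀ g : EuclideanSpace ℂ (Fin k), 0 ≤ ∑ l, ‖∑ j, U l j * g j‖ ^ 2 := fun g => by positivity
  have hP0 : 0 < P := by
    obtain ⟨g, hg⟩ := hae.exists
    have h1 := (hpos g hg).trans_le (hb g)
    exact pos_of_mul_pos_right h1 (pow_nonneg (hx0 g) _)
  have hlog : ∀ᵐ g ∂μ, Real.log n.factorial + ∑ i, Real.log (‖∑ j, (Bᴴ * U) i j * g j‖ ^ 2)
      ≤ n * ((∑ l, ‖∑ j, U l j * g j‖ ^ 2) / 2 - 1 + Real.log 2) + Real.log P := by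
    filter_upwards [hae] with g hg
    have h1 := (hpos g hg).trans_le (hb g)
    have hne : ∀ i, ‖∑ j, (Bᴴ * U) i j * g j‖ ^ 2 ≠ 0 := fun i => by
      have := norm_pos_iff.2 (hg i)
      positivity
    have h2 := Real.log_le_log (hpos g hg) (hb g)
    have hx : 0 < ∑ l, ‖∑ j, U l j * g j‖ ^ 2 := by
      refine lt_of_le_of_ne (hx0 g) fun h => ?_
      rw [← h, zero_pow hn.ne', zero_mul] at h1
      exact lt_irrefl _ h1
    rw [Real.log_mul hfac.ne' (Finset.prod_ne_zero_iff.2 fun i _ => hne i),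
      Real.log_prod (fun i _ => hne i), Real.log_mul (by positivity) hP0.ne', Real.log_pow] at h2
    have h3 : Real.log (∑ l, ‖∑ j, U l j * g j‖ ^ 2) ≤ (∑ l, ‖∑ j, U l j * g j‖ ^ 2) / 2 - 1 + Real.log 2 := by
      have := Real.log_le_sub_one_of_pos (half_pos hx)
      rw [Real.log_div hx.ne' two_ne_zero] at this
      linarith
    have h4 := mul_le_mul_of_nonneg_left h3 (Nat.cast_nonneg (α := ℝ) n)
    linarith
  have i1 : ∀ i, Integrable (fun g : EuclideanSpace ℂ (Fin k) => Real.log (‖∑ j, (Bᴴ * U) i j * g j‖ ^ 2)) μ :=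
    fun i => ((gauss_lin (fun j => (Bᴴ * U) i j)).2 (hq i)).2.1
  have i2 : ∀ l, Integrable (fun g : EuclideanSpace ℂ (Fin k) => ‖∑ j, U l j * g j‖ ^ 2) μ :=
    fun l => (gauss_lin (fun j => U l j)).1.1
  have i3 : Integrable (fun g : EuclideanSpace ℂ (Fin k) => ∑ l, ‖∑ j, U l j * g j‖ ^ 2) μ :=
    integrable_finsetSum _ fun l _ => i2 l
  have i4 : Integrable (fun g : EuclideanSpace ℂ (Fin k) => ∑ i, Real.log (‖∑ j, (Bᴴ * U) i j * g j‖ ^ 2)) μ :=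
    integrable_finsetSum _ fun l _ => i1 l
  have i5 : Integrable (fun g : EuclideanSpace ℂ (Fin k) => (∑ l, ‖∑ j, U l j * g j‖ ^ 2) / 2 - 1 + Real.log 2) μ :=
    ((i3.div_const 2).sub (integrable_const _)).add (integrable_const _)
  have hI := integral_mono_ae ((integrable_const _).add i4) ((i5.const_mul (n:ℝ)).add (integrable_const _)) hlog
  have e3 : ∫ g, (∑ l, ‖∑ j, U l j * g j‖ ^ 2) ∂μ = 2 := by
    rw [integral_finsetSum _ fun l _ => i2 l]
    have : ∀ l, ∫ g, ‖∑ j, U l j * g j‖ ^ 2 ∂μ = 2 * ∑ j, ‖U l j‖ ^ 2 := fun l => (gauss_lin (fun j => U l j)).1.2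
    simp_rw [this]
    rw [← Finset.mul_sum, hU, mul_one]
  have e4 : ∫ g, (∑ i, Real.log (‖∑ j, (Bᴴ * U) i j * g j‖ ^ 2)) ∂μ
      = ∑ i, (Real.log (∑ j, ‖(Bᴴ * U) i j‖ ^ 2) + Real.log 2 - Real.eulerMascheroniConstant) := by
    rw [integral_finsetSum _ fun l _ => i1 l]
    exact Finset.sum_congr rfl fun i _ => ((gauss_lin (fun j => (Bᴴ * U) i j)).2 (hq i)).2.2
  have e5 : ∫ g, ((∑ l, ‖∑ j, U l j * g j‖ ^ 2) / 2 - 1 + Real.log 2) ∂μ = Real.log 2 := by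
    have e6 : ∀ g : EuclideanSpace ℂ (Fin k), (∑ l, ‖∑ j, U l j * g j‖ ^ 2) / 2 - 1 + Real.log 2
        = (∑ l, ‖∑ j, U l j * g j‖ ^ 2) / 2 + (-1 + Real.log 2) := fun g => by ring
    simp_rw [e6]
    rw [integral_add (i3.div_const 2) (integrable_const _), integral_div, e3]
    simp [μ]
  have hI' : Real.log n.factorial + ∑ i, (Real.log (∑ j, ‖(Bᴴ * U) i j‖ ^ 2) + Real.log 2 - Real.eulerMascheroniConstant)
      ≤ n * Real.log 2 + Real.log P := by
    have a1 := integral_add (μ := μ) (integrable_const (Real.log n.factorial)) i4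
    have a2 := integral_add (μ := μ) (i5.const_mul (n:ℝ)) (integrable_const (Real.log P))
    rw [integral_const_mul, e5] at a2
    rw [e4] at a1
    simp only [integral_const, one_smul, probReal_univ, μ] at a1 a2
    rw [← a1, ← a2]
    exact hI
  rw [Finset.sum_sub_distrib, Finset.sum_add_distrib] at hI'
  simp only [Finset.sum_const, Finset.card_univ, Fintype.card_fin, nsmul_eq_mul] at hI'
  rw [← Real.log_prod (fun i _ => (hq i).ne')] at hI'
  have hQ : 0 < ∏ i, ∑ j, ‖(Bᴴ * U) i j‖ ^ 2 := Finset.prod_pos fun i _ => hq i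
  rw [← Real.log_le_log_iff (by positivity) hP0, Real.log_mul (by positivity) hQ.ne',
    Real.log_mul (by positivity) (by positivity), Real.log_exp]
  linarith

lemma psd_diag {n m : ℕ} (B : Matrix (Fin m) (Fin n) ℂ) (d : Fin n → ℝ)
    (h : ∀ z : Fin n → ℂ, ∑ l, ‖(B *ᵥ z) l‖ ^ 2 ≤ ∑ i, d i * ‖z i‖ ^ 2) :
    (Matrix.diagonal (fun i => (d i : ℂ)) - Bᴴ * B).PosSemidef := by
  refine Matrix.PosSemidef.of_dotProduct_mulVec_nonneg ?_ ?_
  · refine Matrix.IsHermitian.sub ?_ (Matrix.isHermitian_conjTranspose_mul_self B)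
    refine Matrix.isHermitian_diagonal_of_self_adjoint _ ?_
    ext i
    simp
  · intro z
    have e : star z ⬝ᵥ (Matrix.diagonal (fun i => (d i : ℂ)) - Bᴴ * B) *ᵥ z
        = ((∑ i, d i * ‖z i‖ ^ 2 - ∑ l, ‖(B *ᵥ z) l‖ ^ 2 : ℝ) : ℂ) := by
      rw [Matrix.sub_mulVec, dotProduct_sub, ← Matrix.mulVec_mulVec, Matrix.dotProduct_mulVec (star z) Bᴴ,
        ← Matrix.star_mulVec]
      simp only [dotProduct, Matrix.mulVec_diagonal, Pi.star_apply, RCLike.star_def]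
      push_cast
      congr 1
      · refine Finset.sum_congr rfl fun i _ => ?_
        rw [← Complex.conj_mul']
        ring
      · exact Finset.sum_congr rfl fun i _ => Complex.conj_mul' _
    rw [e]
    exact_mod_cast sub_nonneg.2 (h z)

lemma crude {n m : ℕ} (B : Matrix (Fin m) (Fin n) ℂ) (s : Fin n → ℝ) (hs : ∀ j, s j = 1 ∨ (s j = 0 ∧ ∀ l, B l j = 0)) :
    (Matrix.diagonal (fun i => (((∑ l, ∑ j, ‖B l j‖ ^ 2) * s i : ℝ) : ℂ)) - Bᴴ * B).PosSemidef := by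
  refine psd_diag B _ fun z => ?_
  have h : ∀ l, ‖(B *ᵥ z) l‖ ^ 2 ≤ (∑ j, ‖B l j‖ ^ 2) * ∑ j, s j * ‖z j‖ ^ 2 := by
    intro l
    have h1 : ‖(B *ᵥ z) l‖ ≤ ∑ j, ‖B l j‖ * (s j * ‖z j‖) := by
      refine (norm_sum_le Finset.univ (fun j => B l j * z j)).trans_eq (Finset.sum_congr rfl fun j _ => ?_)
      rcases hs j with h | ⟨h, h'⟩
      · simp [h]
      · simp [h, h']
    have h2 := Finset.sum_mul_sq_le_sq_mul_sq Finset.univ (fun j => ‖B l j‖) (fun j => s j * ‖z j‖)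
    have h3 : ∀ j, (s j * ‖z j‖) ^ 2 = s j * ‖z j‖ ^ 2 := by
      intro j
      rcases hs j with h | ⟨h, h'⟩ <;> simp [h]
    simp_rw [h3] at h2
    exact (pow_le_pow_left₀ (norm_nonneg _) h1 2).trans h2
  refine (Finset.sum_le_sum fun l _ => h l).trans_eq ?_
  rw [← Finset.sum_mul, Finset.mul_sum]
  exact Finset.sum_congr rfl fun j _ => by ring

lemma first_order {n : ℕ} (q p : Fin n → ℝ) (hq : ∀ i, 0 < q i)
    (h : ∀ t : ℝ, 0 < t → t ≤ 1 → ∏ i, ((1 - t) * q i + t * p i) ≤ ∏ i, q i) :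
    ∑ i, p i / q i ≤ n := by
  have hd : ∀ i ∈ (Finset.univ : Finset (Fin n)), HasDerivAt (fun t : ℝ => 1 + t * (p i / q i - 1)) (p i / q i - 1) 0 := by
    intro i _
    simpa using ((hasDerivAt_id (0:ℝ)).mul_const (p i / q i - 1)).const_add 1
  have hD := HasDerivAt.fun_finsetProd hd
  simp only [zero_mul, add_zero, Finset.prod_const_one, one_smul] at hD
  have hD' := (hasDerivWithinAt_iff_tendsto_slope' (s := Set.Ioi (0:ℝ)) (by simp)).1 hD.hasDerivWithinAt
  have hle : ∑ i, (p i / q i - 1) ≤ 0 := by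
    refine le_of_tendsto hD' ?_
    filter_upwards [Ioc_mem_nhdsGT (zero_lt_one' ℝ)] with t ht
    have h1 := h t ht.1 ht.2
    have h2 : ∏ i, ((1 - t) * q i + t * p i) = (∏ i, q i) * ∏ i, (1 + t * (p i / q i - 1)) := by
      rw [← Finset.prod_mul_distrib]
      refine Finset.prod_congr rfl fun i _ => ?_
      have := (hq i).ne'
      field_simp
      ring
    rw [h2] at h1
    have h3 : ∏ i, (1 + t * (p i / q i - 1)) ≤ 1 := by
      have hQ : 0 < ∏ i, q i := Finset.prod_pos fun i _ => hq i
      by_contra! hc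
      nlinarith
    rw [slope_def_field]
    simp only [zero_mul, add_zero, Finset.prod_const_one, sub_zero]
    exact div_nonpos_of_nonpos_of_nonneg (by linarith) ht.1.le
  rw [Finset.sum_sub_distrib] at hle
  simpa using hle

lemma diag_entry {n m k : ℕ} (B : Matrix (Fin m) (Fin n) ℂ) (U : Matrix (Fin m) (Fin k) ℂ) (i : Fin n) :
    ((Bᴴ * (U * Uᴴ) * B) i i) = ((∑ j, ‖(Bᴴ * U) i j‖ ^ 2 : ℝ) : ℂ) := by
  have : Bᴴ * (U * Uᴴ) * B = (Bᴴ * U) * (Bᴴ * U)ᴴ := by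
    rw [Matrix.conjTranspose_mul, Matrix.conjTranspose_conjTranspose]
    simp only [Matrix.mul_assoc]
  rw [this, Matrix.mul_apply]
  push_cast
  refine Finset.sum_congr rfl fun j _ => ?_
  rw [Matrix.conjTranspose_apply]
  exact Complex.mul_conj' _

lemma trace_entry {m k : ℕ} (U : Matrix (Fin m) (Fin k) ℂ) :
    (U * Uᴴ).trace = ((∑ i, ∑ j, ‖U i j‖ ^ 2 : ℝ) : ℂ) := by
  rw [Matrix.trace]
  push_cast
  refine Finset.sum_congr rfl fun i _ => ?_
  rw [Matrix.diag_apply, Matrix.mul_apply]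
  exact Finset.sum_congr rfl fun j _ => Complex.mul_conj' _

lemma opt {n : ℕ} (hn : 0 < n) (B : Matrix (Fin n) (Fin n) ℂ) (hB : ∀ i, ∃ l, B l i ≠ 0) :
    ∃ U : Matrix (Fin n) (Fin n) ℂ, ∑ i, ∑ j, ‖U i j‖ ^ 2 = 1 ∧
      (∀ i, 0 < ∑ j, ‖(Bᴴ * U) i j‖ ^ 2) ∧
      (Matrix.diagonal (fun i => ((n * ∑ j, ‖(Bᴴ * U) i j‖ ^ 2 : ℝ) : ℂ)) - Bᴴ * B).PosSemidef := by
  have hn' : (0:ℝ) < n := by exact_mod_cast hn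
  let K : Set (Fin n → Fin n → ℂ) := {U | ∑ i, ∑ j, ‖U i j‖ ^ 2 = 1}
  have hK : IsCompact K := by
    refine Metric.isCompact_of_isClosed_isBounded (isClosed_eq (by fun_prop) continuous_const) ?_
    refine (Metric.isBounded_closedBall (x := 0) (r := 1)).subset fun U hU => ?_
    rw [mem_closedBall_zero_iff, pi_norm_le_iff_of_nonneg zero_le_one]
    intro i
    rw [pi_norm_le_iff_of_nonneg zero_le_one]
    intro j
    have h1 : ‖U i j‖ ^ 2 ≤ ∑ j, ‖U i j‖ ^ 2 :=
      Finset.single_le_sum (f := fun j => ‖U i j‖ ^ 2) (fun _ _ => by positivity) (Finset.mem_univ j)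
    have h2 : ∑ j, ‖U i j‖ ^ 2 ≤ ∑ i, ∑ j, ‖U i j‖ ^ 2 :=
      Finset.single_le_sum (f := fun i => ∑ j, ‖U i j‖ ^ 2) (fun _ _ => by positivity) (Finset.mem_univ i)
    have h3 : ∑ i, ∑ j, ‖U i j‖ ^ 2 = 1 := hU
    rw [h3] at h2
    have := h1.trans h2
    exact (sq_le_one_iff₀ (norm_nonneg _)).1 this
  let Φ : (Fin n → Fin n → ℂ) → ℝ := fun U => ∏ i, ∑ j, ‖∑ l, Bᴴ i l * U l j‖ ^ 2
  have hΦ : Continuous Φ := by fun_prop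
  let U0 : Fin n → Fin n → ℂ := fun i j => if i = j then ((Real.sqrt n)⁻¹ : ℝ) else 0
  have hU0n : ∀ i j, ‖U0 i j‖ ^ 2 = if i = j then (n:ℝ)⁻¹ else 0 := by
    intro i j
    by_cases h : i = j
    · simp only [U0, h, if_true, Complex.norm_real, Real.norm_eq_abs, sq_abs, inv_pow]
      rw [Real.sq_sqrt hn'.le]
    · simp [U0, h]
  have hU0 : U0 ∈ K := by
    change ∑ i, ∑ j, ‖U0 i j‖ ^ 2 = 1
    simp_rw [hU0n]
    simp [hn'.ne']
  obtain ⟨U, hUK, hmax⟩ := hK.exists_isMaxOn ⟨U0, hU0⟩ hΦ.continuousOn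
  have hU1 : ∑ i, ∑ j, ‖U i j‖ ^ 2 = 1 := hUK
  set q : Fin n → ℝ := fun i => ∑ j, ‖(Bᴴ * (Matrix.of U)) i j‖ ^ 2 with hqdef
  have hΦU : Φ U = ∏ i, q i := rfl
  have hΦ0 : 0 < Φ U0 := by
    refine Finset.prod_pos fun i _ => ?_
    obtain ⟨l, hl⟩ := hB i
    refine Finset.sum_pos' (fun _ _ => by positivity) ⟨l, Finset.mem_univ _, ?_⟩
    have : ∑ l', Bᴴ i l' * U0 l' l = Bᴴ i l * ((Real.sqrt n)⁻¹ : ℝ) := by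
      simp [U0]
    rw [this]
    have h1 : Bᴴ i l * (((Real.sqrt n)⁻¹ : ℝ) : ℂ) ≠ 0 := by
      refine mul_ne_zero (by simpa using hl) ?_
      have : Real.sqrt n ≠ 0 := (Real.sqrt_pos.2 hn').ne'
      simpa using this
    have := norm_pos_iff.2 h1
    positivity
  have hQ : 0 < ∏ i, q i := hΦU ▸ hΦ0.trans_le (hmax hU0)
  have hq : ∀ i, 0 < q i := by
    intro i
    refine lt_of_le_of_ne (by positivity) fun h => ?_
    rw [Finset.prod_eq_zero (Finset.mem_univ i) h.symm] at hQ
    exact lt_irrefl _ hQ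
  refine ⟨Matrix.of U, hU1, hq, psd_diag B _ fun z => ?_⟩
  set x := B *ᵥ z with hx
  set c := ∑ l, ‖x l‖ ^ 2 with hc
  have hc0 : 0 ≤ c := by positivity
  rcases hc0.eq_or_lt with h0 | hcpos
  · rw [← h0]
    exact Finset.sum_nonneg fun i _ => mul_nonneg (mul_nonneg hn'.le (hq i).le) (by positivity)
  set w := Bᴴ *ᵥ x with hw
  have hfo : ∑ i, (c⁻¹ * ‖w i‖ ^ 2) / q i ≤ n := by
    refine first_order q _ hq fun t ht0 ht1 => ?_
    let X : Matrix (Fin n) (Fin 1) ℂ := Matrix.of fun i _ => x i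
    let Y : Matrix (Fin n) (Fin n) ℂ := ((1 - t : ℝ) : ℂ) • (Matrix.of U * (Matrix.of U)ᴴ) + ((t * c⁻¹ : ℝ) : ℂ) • (X * Xᴴ)
    have hY : Y.PosSemidef := by
      refine ((Matrix.posSemidef_self_mul_conjTranspose _).smul ?_).add ((Matrix.posSemidef_self_mul_conjTranspose _).smul ?_)
      · exact_mod_cast sub_nonneg.2 ht1
      · exact_mod_cast (by positivity : 0 ≤ t * c⁻¹)
    obtain ⟨V, hV⟩ := psd_factor _ hY
    have hV' : Y = Vᴴ * (Vᴴ)ᴴ := by rw [hV, Matrix.conjTranspose_conjTranspose]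
    have htr : Y.trace = 1 := by
      simp only [Y]
      rw [Matrix.trace_add, Matrix.trace_smul, Matrix.trace_smul, trace_entry, trace_entry]
      have e1 : ∑ i, ∑ j, ‖(Matrix.of U) i j‖ ^ 2 = 1 := hU1
      have e2 : ∑ i, ∑ j, ‖X i j‖ ^ 2 = c := by simp [X, hc]
      rw [e1, e2]
      have : (c : ℂ) ≠ 0 := by exact_mod_cast hcpos.ne'
      simp only [smul_eq_mul]
      push_cast
      field_simp
      ring
    have hVK : (fun i j => Vᴴ i j) ∈ K := by
      change ∑ i, ∑ j, ‖Vᴴ i j‖ ^ 2 = 1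
      rw [hV', trace_entry] at htr
      exact_mod_cast htr
    have hm : Φ (fun i j => Vᴴ i j) ≤ Φ U := hmax hVK
    rw [hΦU] at hm
    refine le_trans (le_of_eq ?_) hm
    refine Finset.prod_congr rfl fun i _ => ?_
    have e1 := diag_entry B Vᴴ i
    rw [← hV'] at e1
    have e2 : (Bᴴ * Y * B) i i = ((1 - t : ℝ) : ℂ) * (Bᴴ * (Matrix.of U * (Matrix.of U)ᴴ) * B) i i + ((t * c⁻¹ : ℝ) : ℂ) * (Bᴴ * (X * Xᴴ) * B) i i := by
      simp only [Y]
      rw [Matrix.mul_add, Matrix.add_mul, Matrix.mul_smul, Matrix.mul_smul, Matrix.smul_mul, Matrix.smul_mul]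
      simp
    rw [e1, diag_entry, diag_entry] at e2
    have e3 : ∑ j, ‖(Bᴴ * X) i j‖ ^ 2 = ‖w i‖ ^ 2 := by
      simp [X, hw, Matrix.mul_apply, Matrix.mulVec, dotProduct]
    rw [e3] at e2
    have e4 : ∑ j, ‖(Bᴴ * Vᴴ) i j‖ ^ 2 = (1 - t) * q i + (t * c⁻¹) * ‖w i‖ ^ 2 := by
      exact_mod_cast e2
    rw [← mul_assoc, ← e4]
    rfl
  have hfo2 : ∑ i, ‖w i‖ ^ 2 / (n * q i) ≤ c := by
    have e : ∑ i, ‖w i‖ ^ 2 / (n * q i) = (c / n) * ∑ i, (c⁻¹ * ‖w i‖ ^ 2) / q i := by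
      rw [Finset.mul_sum]
      refine Finset.sum_congr rfl fun i _ => ?_
      have := (hq i).ne'
      field_simp
    rw [e]
    calc _ ≤ (c / n) * n := mul_le_mul_of_nonneg_left hfo (by positivity)
      _ = c := by field_simp
  have hcw : (c : ℂ) = ∑ i, star (z i) * w i := by
    have : star x ⬝ᵥ x = star z ⬝ᵥ w := by
      rw [hw, Matrix.dotProduct_mulVec (star z), ← Matrix.star_mulVec]
    have h2 : star x ⬝ᵥ x = (c : ℂ) := by
      simp [dotProduct, Complex.conj_mul', hc]
    rw [← h2, this]
    rfl
  have hle : c ≤ ∑ i, ‖z i‖ * ‖w i‖ := by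
    have h1 : ‖(c:ℂ)‖ = c := by rw [Complex.norm_real, Real.norm_of_nonneg hc0]
    rw [← h1, hcw]
    refine (norm_sum_le _ _).trans_eq (Finset.sum_congr rfl fun i _ => ?_)
    simp
  have ham : ∀ i, 2 * (‖z i‖ * ‖w i‖) ≤ n * q i * ‖z i‖ ^ 2 + ‖w i‖ ^ 2 / (n * q i) := by
    intro i
    have hp : 0 < n * q i := mul_pos hn' (hq i)
    have : n * q i * ‖z i‖ ^ 2 + ‖w i‖ ^ 2 / (n * q i) - 2 * (‖z i‖ * ‖w i‖) = (n * q i * ‖z i‖ - ‖w i‖) ^ 2 / (n * q i) := by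
      have := (hq i).ne'
      field_simp
      ring
    have h2 : 0 ≤ (n * q i * ‖z i‖ - ‖w i‖) ^ 2 / (n * q i) := by positivity
    linarith
  have hs := Finset.sum_le_sum fun i (_ : i ∈ Finset.univ) => ham i
  rw [← Finset.mul_sum, Finset.sum_add_distrib] at hs
  linarith

theorem perm_approx (n : ℕ) (A : Matrix (Fin n) (Fin n) ℂ) (hA : A.PosSemidef) :
    (perm A).re ≤ sInf (relSet A) ∧
      Real.exp (-(n * (Real.eulerMascheroniConstant + 1))) * sInf (relSet A) ≤
        (perm A).re := by
  have hup := upper A hA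
  have hbdd : BddBelow (relSet A) := ⟨_, hup⟩
  obtain ⟨B, rfl⟩ := psd_factor _ hA
  refine ⟨le_csInf ⟨_, _, crude B (fun _ => 1) (fun _ => Or.inl rfl), rfl⟩ hup, ?_⟩
  rcases Nat.eq_zero_or_pos n with rfl | hn
  · have : sInf (relSet (Bᴴ * B)) ≤ 1 :=
      csInf_le hbdd ⟨_, crude B (fun _ => 1) (fun _ => Or.inl rfl), by simp⟩
    simpa [perm] using this
  by_cases hB : ∀ i, ∃ l, B l i ≠ 0
  · obtain ⟨U, hU, hq, hD⟩ := opt hn B hB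
    have h1 := csInf_le hbdd ⟨_, hD, rfl⟩
    refine le_trans ?_ (lower_core hn B U hU hq)
    refine (mul_le_mul_of_nonneg_left h1 (Real.exp_pos _).le).trans ?_
    have hQ : 0 < ∏ i, ∑ j, ‖(Bᴴ * U) i j‖ ^ 2 := Finset.prod_pos fun i _ => hq i
    rw [Finset.prod_mul_distrib, Finset.prod_const, Finset.card_univ, Fintype.card_fin, ← mul_assoc]
    refine mul_le_mul_of_nonneg_right ?_ hQ.le
    have h2 := Real.pow_div_factorial_le_exp (n:ℝ) (Nat.cast_nonneg n) n
    have hfac : (0:ℝ) < n.factorial := by exact_mod_cast n.factorial_pos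
    rw [div_le_iff₀ hfac] at h2
    have h3 : Real.exp (-(n * (Real.eulerMascheroniConstant + 1)))
        = Real.exp (-(n * Real.eulerMascheroniConstant)) * (Real.exp n)⁻¹ := by
      rw [← Real.exp_neg, ← Real.exp_add]
      congr 1
      ring
    rw [h3, mul_assoc, mul_comm (n.factorial : ℝ)]
    refine mul_le_mul_of_nonneg_left ?_ (Real.exp_pos _).le
    rw [inv_mul_le_iff₀ (Real.exp_pos _)]
    exact h2
  · push Not at hB
    obtain ⟨i, hi⟩ := hB
    have h1 : sInf (relSet (Bᴴ * B)) ≤ 0 := by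
      refine csInf_le hbdd ⟨_, crude B (fun j => if j = i then 0 else 1) ?_, ?_⟩
      · intro j
        by_cases h : j = i
        · exact Or.inr ⟨by simp [h], by rw [h]; exact hi⟩
        · exact Or.inl (by simp [h])
      · exact Finset.prod_eq_zero (Finset.mem_univ i) (by simp)
    have h2 : 0 ≤ (perm (Bᴴ * B)).re := by
      have := perm_mono 0 (Bᴴ * B) Matrix.PosSemidef.zero (by simpa using hA)
      have h0 : perm (0 : Matrix (Fin n) (Fin n) ℂ) = 0 := by
        simp [perm, hn.ne']
      rwa [h0] at this
    exact (mul_nonpos_of_nonneg_of_nonpos (Real.exp_pos _).le h1).trans h2
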